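/- Let n ≥ 3, let e_1,…,e_n be the standard basis of ℚ^n, and let S = {e_1,…,e_n, e_1−e_2, e_2−e_3, …, e_{n−1}−e_n, e_n−e_1} ⊆ ℚ^n. If U is a ℚ-subspace of ℚ^n with 0 ≠ U ≠ ℚ^n that is spanned by some subset of S, then there exist distinct vectors v, w ∈ S with v ∉ U, w ∉ U, and either v − w ∈ U or v + w ∈ U. -/

import Mathlib

/-- let `n ≥ 3`, let `e_1,…,e_n` be the standard basis of `ℚ^n`
and `S = {e_1,…,e_n, e_1-e_2, …, e_{n-1}-e_n, e_n-e_1}`. If `U` is a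
`ℚ`-subspace of `ℚ^n` with `0 ≠ U ≠ ℚ^n` spanned by a subset of `S`, then
there are distinct `v, w ∈ S` with `v ∉ U`, `w ∉ U` and `v - w ∈ U` or
`v + w ∈ U`. -/
theorem statement14 (n : ℕ) (hn : 3 ≤ n)
    (S : Set (Fin n → ℚ))
    (hS : S = (Set.range fun j : Fin n => (Pi.single j 1 : Fin n → ℚ)) ∪
      (Set.range fun j : Fin n =>
        (Pi.single j 1 : Fin n → ℚ) -
          Pi.single (⟨((j : ℕ) + 1) % n, Nat.mod_lt _ (by omega)⟩ : Fin n) 1))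
    (U : Submodule ℚ (Fin n → ℚ)) (hU0 : U ≠ ⊥) (hUtop : U ≠ ⊤)
    (hUspan : ∃ s ⊆ S, U = Submodule.span ℚ s) :
    ∃ v ∈ S, ∃ w ∈ S, v ≠ w ∧ v ∉ U ∧ w ∉ U ∧ (v - w ∈ U ∨ v + w ∈ U) := by
  obtain ⟨s, hsS, rfl⟩ := hUspan
  set U := Submodule.span ℚ s with hU
  let nx : Fin n → Fin n := fun j => ⟨((j : ℕ) + 1) % n, Nat.mod_lt _ (by omega)⟩
  let e : Fin n → Fin n → ℚ := fun j => Pi.single j 1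
  have hnx : ∀ j, j ≠ nx j := by
    intro j h
    have h' : (j : ℕ) = ((j : ℕ) + 1) % n := congrArg Fin.val h
    rcases Nat.lt_or_ge ((j : ℕ) + 1) n with hj | hj
    · rw [Nat.mod_eq_of_lt hj] at h'
      omega
    · have hj' : (j : ℕ) + 1 = n := by omega
      rw [hj', Nat.mod_self] at h'
      omega
  have he : ∀ j, e j ∈ S := fun j => hS ▸ Or.inl ⟨j, rfl⟩
  have hd : ∀ j, e j - e (nx j) ∈ S := fun j => hS ▸ Or.inr ⟨j, rfl⟩
  by_cases hexists : ∃ j, e j ∈ U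
  · obtain ⟨j, hj⟩ := hexists
    by_cases hstep : ∀ i, e i ∈ U → e (nx i) ∈ U
    · have hshift : ∀ k : ℕ, e ⟨((j : ℕ) + k) % n, Nat.mod_lt _ (by omega)⟩ ∈ U := by
        intro k
        induction k with
        | zero => simpa [Nat.mod_eq_of_lt j.isLt] using hj
        | succ k ih =>
          have h := hstep _ ih
          simpa [nx, Nat.add_assoc] using h
      have hall : ∀ i, e i ∈ U := by
        intro i
        have h := hshift (n - j + i)
        have hi : ((j : ℕ) + (n - j + i)) % n = i := by
          rw [show (j : ℕ) + (n - j + i) = i + n by omega, Nat.add_mod_right,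
            Nat.mod_eq_of_lt i.isLt]
        simpa only [hi] using h
      refine absurd (eq_top_iff.2 ?_) hUtop
      rw [← (Pi.basisFun ℚ (Fin n)).span_eq, Submodule.span_le]
      rintro _ ⟨i, rfl⟩
      simpa [e] using hall i
    · push Not at hstep
      obtain ⟨i, hi, hi'⟩ := hstep
      refine ⟨_, hd i, _, he (nx i), ?_, ?_, hi', Or.inr (by simpa using hi)⟩
      · intro h
        simpa [e, hnx i] using congrFun h i
      · intro h
        exact hi' (by simpa using U.sub_mem hi h)
  · push Not at hexists
    by_cases hrim : ∃ j, e j - e (nx j) ∈ U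
    · obtain ⟨j, hj⟩ := hrim
      refine ⟨_, he j, _, he (nx j), ?_, hexists _, hexists _, Or.inl hj⟩
      intro h
      simpa [e, hnx j] using congrFun h j
    · push Not at hrim
      refine absurd (Submodule.span_eq_bot.2 ?_) hU0
      intro x hx
      have hxU : x ∈ U := Submodule.subset_span hx
      have hxS := hsS hx
      rw [hS] at hxS
      rcases hxS with ⟨j, rfl⟩ | ⟨j, rfl⟩
      · exact absurd hxU (hexists j)
      · exact absurd hxU (hrim j)
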